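/- arXiv:1604.03270 — 2 statements merged into one kernel-verified Lean document; each statement's English description precedes it below -/
import Mathlib

section
/- Let A=(Q,Σ,δ,ρ) be a connected bireversible Mealy automaton whose orbit tree o(A) has no active self-liftable branch, and let j be a jungle tree of o(A) with trunk of length n and trunk edge labels k_1,…,k_n (from the root down). For every 0≤i≤n and every j-word u of length i, the number of stems having u as a prefix equals the product k_{i+1}·k_{i+2}⋯k_n; in particular it depends only on i. -/
open List

variable {Q A : Type*}

/-- Action of a state on words over the alphabet:
`ρ_x(i·s) = ρ_x(i) · ρ_{δ_i(x)}(s)`. -/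
def mrho (d : A → Q → Q) (r : Q → A → A) : Q → List A → List A
  | _, [] => []
  | x, i :: s => r x i :: mrho d r (d i x) s

/-- Action of a word of states: `ρ_{x₁⋯x_m} = ρ_{x_m} ∘ ⋯ ∘ ρ_{x₁}`. -/
def mrhoW (d : A → Q → Q) (r : Q → A → A) : List Q → List A → List A
  | [], s => s
  | x :: u, s => mrhoW d r u (mrho d r x s)

/-- Dual action of a letter on words of states:
`δ_i(x·u) = δ_i(x) · δ_{ρ_x(i)}(u)`. -/
def mdel (d : A → Q → Q) (r : Q → A → A) : A → List Q → List Q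
  | _, [] => []
  | i, x :: u => d i x :: mdel d r (r x i) u

/-- Action of a word of letters: `δ_{s₁⋯s_m} = δ_{s_m} ∘ ⋯ ∘ δ_{s₁}`. -/
def mdelW (d : A → Q → Q) (r : Q → A → A) : List A → List Q → List Q
  | [], u => u
  | i :: s, u => mdelW d r s (mdel d r i u)

/-- Connected component (orbit under the dual action) of a word of states. -/
def mOrbit (d : A → Q → Q) (r : Q → A → A) (u : List Q) : Set (List Q) :=
  { v | ∃ s : List A, mdelW d r s u = v }

/-- The Mealy automaton is invertible. -/
def MInvertible (r : Q → A → A) : Prop := ∀ x : Q, Function.Bijective (r x)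

/-- The Mealy automaton is reversible. -/
def MReversible (d : A → Q → Q) : Prop := ∀ i : A, Function.Bijective (d i)

/-- The Mealy automaton is connected. -/
def MConnected (d : A → Q → Q) (r : Q → A → A) : Prop :=
  ∀ x y : Q, ∃ s : List A, mdelW d r s [x] = [y]

/-- The Mealy automaton is bireversible: invertible, reversible, and for each output
letter `j`, the map sending `x` to `δ_i(x)` (where `i` is the unique letter with
`ρ_x(i) = j`) is a permutation of the (finite) stateset, encoded as injectivity. -/
def MBireversible (d : A → Q → Q) (r : Q → A → A) : Prop :=
  MInvertible r ∧ MReversible d ∧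
    ∀ (x y : Q) (i i' : A), r x i = r y i' → d i x = d i' y → x = y

/-- The edge of the orbit tree whose bottom is the component of `e` is liftable
to the edge whose bottom is the component of `f`: every word of `⊥(e)` admits
some word of `⊥(f)` as a suffix. -/
def EdgeLiftable (d : A → Q → Q) (r : Q → A → A) (e f : List Q) : Prop :=
  ∀ v ∈ mOrbit d r e, ∃ v' ∈ mOrbit d r f, v' <:+ v

/-- Prefix of length `m` of the infinite word `α : ℕ → Q`. -/
def branchPrefix (α : ℕ → Q) (m : ℕ) : List Q := (List.range m).map α

/-- The orbit tree admits an active self-liftable branch: a branch, represented by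
an infinite word `α`, which is `k`-self-liftable for some `k ≥ 1` (every edge at
level `j + k` of the branch is liftable to the edge at level `j`), and active
(its label sequence is not eventually `1`, i.e. the sizes of the components of the
prefixes do not become eventually constant). -/
def HasActiveSelfLiftableBranch (d : A → Q → Q) (r : Q → A → A) : Prop :=
  ∃ (α : ℕ → Q) (k : ℕ), 1 ≤ k ∧
    (∀ j : ℕ, 1 ≤ j → EdgeLiftable d r (branchPrefix α (j + k)) (branchPrefix α j)) ∧
    ∀ N : ℕ, ∃ m : ℕ, N ≤ m ∧
      (mOrbit d r (branchPrefix α (m + 1))).ncard ≠ (mOrbit d r (branchPrefix α m)).ncard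

/-- `t` represents the trunk of a jungle tree: a non-empty finite initial
`1`-self-liftable path (each edge of the trunk is liftable to the preceding one)
such that the bottom of the trunk has at least two legitimate children
(children liftable to the last trunk edge), and every legitimate child has label `1`. -/
def IsJungleTrunk (d : A → Q → Q) (r : Q → A → A) (t : List Q) : Prop :=
  t ≠ [] ∧
  (∀ j : ℕ, 2 ≤ j → j ≤ t.length → EdgeLiftable d r (t.take j) (t.take (j - 1))) ∧
  (∃ x y : Q, mOrbit d r (t ++ [x]) ≠ mOrbit d r (t ++ [y]) ∧
    EdgeLiftable d r (t ++ [x]) t ∧ EdgeLiftable d r (t ++ [y]) t) ∧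
  ∀ x : Q, EdgeLiftable d r (t ++ [x]) t →
    (mOrbit d r (t ++ [x])).ncard = (mOrbit d r t).ncard

/-- `u` is a `j`-word for the jungle tree with trunk `t`: the sequence of connected
components of the prefixes of `u` is an initial path of the jungle tree, i.e. the
component of each prefix of length `i ≤ |t|` coincides with the component of the
corresponding trunk prefix, and each deeper edge is liftable to the last trunk edge. -/
def IsJWord (d : A → Q → Q) (r : Q → A → A) (t u : List Q) : Prop :=
  (∀ i : ℕ, i ≤ u.length → i ≤ t.length → u.take i ∈ mOrbit d r (t.take i)) ∧
  ∀ l : ℕ, t.length ≤ l → l < u.length → EdgeLiftable d r (u.take (l + 1)) t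

/-- A stem is a `j`-word whose length is the length of the trunk. -/
def IsStem (d : A → Q → Q) (r : Q → A → A) (t u : List Q) : Prop :=
  IsJWord d r t u ∧ u.length = t.length

/-- A cyclic `j`-word is a finite word all of whose powers are `j`-words. -/
def IsCyclicJWord (d : A → Q → Q) (r : Q → A → A) (t u : List Q) : Prop :=
  ∀ k : ℕ, IsJWord d r t (List.flatten (List.replicate k u))

/-- The relation `∼` on stems: `u ∼ v` whenever there is `s` such that `u·s·v` is a
`j`-word and `ρ_{u·s}` acts like the identity on `Σ*`. -/
def StemEquiv (d : A → Q → Q) (r : Q → A → A) (t u v : List Q) : Prop :=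
  ∃ s : List Q, IsJWord d r t (u ++ s ++ v) ∧ ∀ w : List A, mrhoW d r (u ++ s) w = w

theorem aux_mdel_length (d : A → Q → Q) (r : Q → A → A) (u : List Q) :
    ∀ i, (mdel d r i u).length = u.length := by
  induction u with
  | nil => intro i; rfl
  | cons x u ih => intro i; simp [mdel, ih]

theorem aux_mdelW_length (d : A → Q → Q) (r : Q → A → A) (s : List A) :
    ∀ u, (mdelW d r s u).length = u.length := by
  induction s with
  | nil => intro u; rfl
  | cons i s ih => intro u; simp [mdelW, ih, aux_mdel_length]

theorem aux_mdel_take (d : A → Q → Q) (r : Q → A → A) (u : List Q) :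
    ∀ i m, (mdel d r i u).take m = mdel d r i (u.take m) := by
  induction u with
  | nil => intro i m; simp [mdel]
  | cons x u ih =>
    intro i m
    cases m with
    | zero => simp [mdel]
    | succ m => simp [mdel, ih]

theorem aux_mdelW_take (d : A → Q → Q) (r : Q → A → A) (s : List A) :
    ∀ u m, (mdelW d r s u).take m = mdelW d r s (u.take m) := by
  induction s with
  | nil => intro u m; rfl
  | cons i s ih => intro u m; simp [mdelW, ih, aux_mdel_take]

theorem aux_mdel_inj (d : A → Q → Q) (r : Q → A → A) (h : MReversible d) (u : List Q) :
    ∀ i v, mdel d r i u = mdel d r i v → u = v := by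
  induction u with
  | nil => intro i v hv; cases v <;> simp_all [mdel]
  | cons x u ih =>
    intro i v hv
    cases v with
    | nil => simp [mdel] at hv
    | cons y v =>
      simp only [mdel, List.cons.injEq] at hv
      have hxy := (h i).1 hv.1
      subst hxy
      rw [ih _ _ hv.2]

theorem aux_mdelW_inj (d : A → Q → Q) (r : Q → A → A) (h : MReversible d) (s : List A) :
    Function.Injective (mdelW d r s) := by
  induction s with
  | nil => intro u v h; exact h
  | cons i s ih => intro u v huv; exact aux_mdel_inj d r h _ _ _ (ih huv)

theorem aux_mdelW_append (d : A → Q → Q) (r : Q → A → A) (s s' : List A) :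
    ∀ u, mdelW d r (s ++ s') u = mdelW d r s' (mdelW d r s u) := by
  induction s with
  | nil => intro u; rfl
  | cons i s ih => intro u; simp [mdelW, ih]

theorem aux_orbit_finite [Finite Q] (d : A → Q → Q) (r : Q → A → A) (u : List Q) :
    (mOrbit d r u).Finite := by
  refine (List.finite_length_eq Q u.length).subset ?_
  rintro v ⟨s, rfl⟩
  exact aux_mdelW_length d r s u

theorem aux_orbit_self (d : A → Q → Q) (r : Q → A → A) (u : List Q) : u ∈ mOrbit d r u :=
  ⟨[], rfl⟩

theorem aux_orbit_step (d : A → Q → Q) (r : Q → A → A) (u v : List Q) (s : List A)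
    (h : v ∈ mOrbit d r u) : mdelW d r s v ∈ mOrbit d r u := by
  obtain ⟨s', rfl⟩ := h
  exact ⟨s' ++ s, aux_mdelW_append d r s' s u⟩

theorem aux_orbit_symm [Finite Q] (d : A → Q → Q) (r : Q → A → A) (h : MReversible d)
    (u v : List Q) (hv : v ∈ mOrbit d r u) : u ∈ mOrbit d r v := by
  obtain ⟨s, hs⟩ := hv
  have hm : Set.MapsTo (mdelW d r s) (mOrbit d r v) (mOrbit d r v) :=
    fun w hw => aux_orbit_step d r v w s hw
  have hsurj := ((aux_orbit_finite d r v).injOn_iff_bijOn_of_mapsTo hm).1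
    (aux_mdelW_inj d r h s).injOn
  obtain ⟨w, hw, hwv⟩ := hsurj.surjOn (aux_orbit_self d r v)
  have : w = u := aux_mdelW_inj d r h s (hwv.trans hs.symm)
  exact this ▸ hw

def auxFib (d : A → Q → Q) (r : Q → A → A) (t : List Q) (m : ℕ) (p : List Q) : Set (List Q) :=
  {w | w ∈ mOrbit d r t ∧ w.take m = p}

theorem auxFib_finite [Finite Q] (d : A → Q → Q) (r : Q → A → A) (t : List Q) (m : ℕ)
    (p : List Q) : (auxFib d r t m p).Finite :=
  (aux_orbit_finite d r t).subset fun _ h => h.1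

theorem auxFib_le [Finite Q] (d : A → Q → Q) (r : Q → A → A) (h : MReversible d) (t : List Q)
    (m : ℕ) (p q : List Q) (hq : q ∈ mOrbit d r p) :
    (auxFib d r t m p).ncard ≤ (auxFib d r t m q).ncard := by
  obtain ⟨s, rfl⟩ := hq
  refine Set.ncard_le_ncard_of_injOn (mdelW d r s) ?_ (aux_mdelW_inj d r h s).injOn
    (auxFib_finite d r t m _)
  rintro w ⟨hw, rfl⟩
  exact ⟨aux_orbit_step d r t w s hw, aux_mdelW_take d r s w m⟩

theorem aux_card [Finite Q] (d : A → Q → Q) (r : Q → A → A) (h : MReversible d) (t : List Q)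
    (m : ℕ) (p : List Q) (hp : p ∈ mOrbit d r (t.take m)) :
    (mOrbit d r t).ncard = (mOrbit d r (t.take m)).ncard * (auxFib d r t m p).ncard := by
  classical
  have hT := aux_orbit_finite d r t
  have hP := aux_orbit_finite d r (t.take m)
  rw [Set.ncard_eq_toFinset_card _ hT, Set.ncard_eq_toFinset_card _ hP]
  rw [Finset.card_eq_sum_card_fiberwise (f := fun w => w.take m) (t := hP.toFinset)]
  · rw [Finset.sum_const_nat (m := (auxFib d r t m p).ncard)]
    intro q hq
    rw [Set.Finite.mem_toFinset] at hq
    have e : (auxFib d r t m q).ncard = (auxFib d r t m p).ncard := by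
      have h1 := fun x hx => auxFib_le d r h t m (t.take m) x hx
      have h2 := fun x hx => auxFib_le d r h t m x (t.take m)
        (aux_orbit_symm d r h _ _ hx)
      exact le_antisymm ((h2 q hq).trans (h1 p hp)) ((h2 p hp).trans (h1 q hq))
    rw [← e, ← Set.ncard_coe_finset]
    congr 1
    ext w
    simp [auxFib]
  · intro w hw
    simp only [Set.Finite.coe_toFinset] at hw ⊢
    obtain ⟨s, rfl⟩ := hw
    exact ⟨s, (aux_mdelW_take d r s t m).symm⟩

theorem aux_pos [Finite Q] (d : A → Q → Q) (r : Q → A → A) (u : List Q) :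
    0 < (mOrbit d r u).ncard :=
  (Set.ncard_pos (aux_orbit_finite d r u)).2 ⟨u, aux_orbit_self d r u⟩

theorem aux_prod (N : ℕ → ℕ) (hd : ∀ l, N l ∣ N (l + 1)) (i n : ℕ) (h : i ≤ n) :
    N i * ∏ l ∈ Finset.Icc (i + 1) n, N l / N (l - 1) = N n := by
  induction n, h using Nat.le_induction with
  | base => simp
  | succ n hn ih =>
    rw [Finset.prod_Icc_succ_top (by omega), ← mul_assoc, ih, Nat.add_sub_cancel]
    exact Nat.mul_div_cancel' (hd n)

/-- For every `j`-word `u` of length `i ≤ n`, the number of stems having `u` as a prefix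
equals the product `k_{i+1} ⋯ k_n` of the labels of the trunk edges below level `i`;
in particular it depends only on `i`. -/
theorem statement14 [Fintype Q] [Fintype A] [Nonempty Q] [Nonempty A]
    (d : A → Q → Q) (r : Q → A → A)
    (hbi : MBireversible d r) (hconn : MConnected d r)
    (hnab : ¬ HasActiveSelfLiftableBranch d r)
    (t : List Q) (ht : IsJungleTrunk d r t)
    (i : ℕ) (hi : i ≤ t.length)
    (u : List Q) (hu : IsJWord d r t u) (hlen : u.length = i) :
    {w : List Q | IsStem d r t w ∧ u <+: w}.ncard =
      ∏ l ∈ Finset.Icc (i + 1) t.length,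
        (mOrbit d r (t.take l)).ncard / (mOrbit d r (t.take (l - 1))).ncard := by
  have hrev := hbi.2.1
  have hset : {w : List Q | IsStem d r t w ∧ u <+: w} = auxFib d r t i u := by
    ext w
    constructor
    · rintro ⟨⟨hw, hl⟩, hp⟩
      refine ⟨?_, ?_⟩
      · have := hw.1 t.length hl.ge le_rfl
        rwa [List.take_length, ← hl, List.take_length] at this
      · rw [← hlen]; exact (List.prefix_iff_eq_take.1 hp).symm
    · rintro ⟨⟨s, rfl⟩, hp⟩
      refine ⟨⟨⟨?_, ?_⟩, aux_mdelW_length d r s t⟩, ?_⟩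
      · intro m _ _
        exact ⟨s, (aux_mdelW_take d r s t m).symm⟩
      · intro l h1 h2
        rw [aux_mdelW_length] at h2
        omega
      · rw [← hp]; exact List.take_prefix _ _
  rw [hset]
  have hu' : u ∈ mOrbit d r (t.take i) := by
    have := hu.1 i hlen.ge hi
    rwa [← hlen, List.take_length, hlen] at this
  have h1 := aux_card d r hrev t i u hu'
  have h2 := aux_prod (fun l => (mOrbit d r (t.take l)).ncard) (by
    intro l
    have := aux_card d r hrev (t.take (l + 1)) l ((t.take (l + 1)).take l)
      (aux_orbit_self d r _)
    rw [List.take_take, Nat.min_eq_left (Nat.le_succ l)] at this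
    exact ⟨_, this⟩) i t.length hi
  simp only [List.take_length] at h2
  exact Nat.eq_of_mul_eq_mul_left (aux_pos d r (t.take i)) (h1.symm.trans h2.symm)
end

section
/- Let A=(Q,Σ,δ,ρ) be a connected bireversible Mealy automaton whose orbit tree o(A) has no active self-liftable branch, and let j be a jungle tree of o(A) with trunk of length n. Fix a j-word u of length less than n, a ∼-class γ of stems containing a stem with prefix u, and an integer k such that |u|+k≤n. Then the number of words v∈Q^k such that u·v is a prefix of a stem of γ depends only on |u| and k (and not on the choice of u or of γ). -/
open List

variable {Q A : Type*}

section Helpers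

variable {d : A → Q → Q} {r : Q → A → A} {t : List Q}

theorem mdelW_nil (s : List A) : mdelW d r s [] = [] := by
  induction s with
  | nil => rfl
  | cons i s ih => simpa [mdelW, mdel] using ih

theorem mdelW_cons (s : List A) (x : Q) (u : List Q) :
    ∃ y, mdelW d r s (x :: u) = y :: mdelW d r (mrho d r x s) u := by
  induction s generalizing x u with
  | nil => exact ⟨x, rfl⟩
  | cons i s ih =>
    obtain ⟨y, hy⟩ := ih (d i x) (mdel d r (r x i) u)
    exact ⟨y, by simpa [mdelW, mdel, mrho] using hy⟩

theorem mdel_length (i : A) (u : List Q) : (mdel d r i u).length = u.length := by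
  induction u generalizing i with
  | nil => rfl
  | cons x u ih => simp [mdel, ih]

theorem mdelW_length (s : List A) (u : List Q) : (mdelW d r s u).length = u.length := by
  induction s generalizing u with
  | nil => rfl
  | cons i s ih => simp [mdelW, ih, mdel_length]

theorem mdel_append (i : A) (u v : List Q) :
    ∃ j, mrhoW d r u [i] = [j] ∧ mdel d r i (u ++ v) = mdel d r i u ++ mdel d r j v := by
  induction u generalizing i with
  | nil => exact ⟨i, rfl, rfl⟩
  | cons x u ih =>
    obtain ⟨j, h1, h2⟩ := ih (r x i)
    exact ⟨j, by simpa [mrhoW, mrho] using h1, by simpa [mdel] using h2⟩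

theorem mrho_cons_word (u : List Q) (i : A) (s : List A) :
    mrhoW d r u (i :: s) = mrhoW d r u [i] ++ mrhoW d r (mdel d r i u) s := by
  induction u generalizing i s with
  | nil => rfl
  | cons x u ih => simp only [mrhoW, mrho, mdel]; rw [ih]

theorem mrhoW_append_word (u : List Q) (s s' : List A) :
    mrhoW d r u (s ++ s') = mrhoW d r u s ++ mrhoW d r (mdelW d r s u) s' := by
  induction s generalizing u with
  | nil =>
    have : mrhoW d r u [] = [] := by
      induction u with
      | nil => rfl
      | cons x u ih => simpa [mrhoW, mrho] using ih
    simp [this, mdelW]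
  | cons i s ih =>
    rw [List.cons_append, mrho_cons_word, ih, mrho_cons_word u i s]
    simp [mdelW]

theorem mrhoW_append (u v : List Q) (s : List A) :
    mrhoW d r (u ++ v) s = mrhoW d r v (mrhoW d r u s) := by
  induction u generalizing s with
  | nil => rfl
  | cons x u ih => simpa [mrhoW] using ih _

theorem mdelW_append (s : List A) (u v : List Q) :
    mdelW d r s (u ++ v) = mdelW d r s u ++ mdelW d r (mrhoW d r u s) v := by
  induction s generalizing u v with
  | nil =>
    have : mrhoW d r u [] = [] := by
      induction u with
      | nil => rfl
      | cons x u ih => simpa [mrhoW, mrho] using ih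
    simp [this, mdelW]
  | cons i s ih =>
    obtain ⟨j, h1, h2⟩ := mdel_append (d := d) (r := r) i u v
    rw [mrho_cons_word, h1]
    simp only [mdelW, h2, ih, List.singleton_append]

theorem mdelW_comp (s s' : List A) (u : List Q) :
    mdelW d r (s ++ s') u = mdelW d r s' (mdelW d r s u) := by
  induction s generalizing u with
  | nil => rfl
  | cons i s ih => simpa [mdelW] using ih _

theorem mdelW_take (s : List A) (u : List Q) (i : ℕ) :
    (mdelW d r s u).take i = mdelW d r s (u.take i) := by
  by_cases h : i ≤ u.length
  · conv_lhs => rw [← List.take_append_drop i u, mdelW_append]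
    rw [List.take_append_of_le_length (by simp [mdelW_length, h])]
    exact List.take_of_length_le (by simp [mdelW_length])
  · rw [List.take_of_length_le (by rw [mdelW_length]; omega),
      List.take_of_length_le (by omega)]

theorem mdel_inj (hr : MReversible d) (i : A) : Function.Injective (mdel d r i) := by
  intro u
  induction u generalizing i with
  | nil => intro v h; cases v <;> simp_all [mdel]
  | cons x u ih =>
    intro v h
    cases v with
    | nil => simp [mdel] at h
    | cons y v =>
      simp only [mdel, List.cons.injEq] at h
      obtain rfl := (hr i).1 h.1
      rw [ih _ h.2]

theorem mdelW_inj (hr : MReversible d) (s : List A) : Function.Injective (mdelW d r s) := by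
  induction s with
  | nil => exact fun _ _ h => h
  | cons i s ih => exact fun u v h => mdel_inj hr i (ih h)

theorem mOrbit_trans {u v w : List Q} (h : v ∈ mOrbit d r u) (h' : w ∈ mOrbit d r v) :
    w ∈ mOrbit d r u := by
  obtain ⟨s, rfl⟩ := h
  obtain ⟨s', rfl⟩ := h'
  exact ⟨s ++ s', mdelW_comp _ _ _⟩

theorem iterate_mem_orbit (s : List A) (u : List Q) (N : ℕ) :
    (mdelW d r s)^[N] u ∈ mOrbit d r u := by
  induction N with
  | zero => exact ⟨[], rfl⟩
  | succ N ih =>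
    rw [Function.iterate_succ_apply']
    exact mOrbit_trans ih ⟨s, rfl⟩

theorem mOrbit_symm [Finite Q] (hr : MReversible d) {u v : List Q} (h : v ∈ mOrbit d r u) :
    u ∈ mOrbit d r v := by
  obtain ⟨s, rfl⟩ := h
  have hfin : {l : List Q | l.length = u.length}.Finite := List.finite_length_eq Q u.length
  have hm : ∀ N, (mdelW d r s)^[N] u ∈ {l : List Q | l.length = u.length} := by
    intro N
    obtain ⟨s', h'⟩ := iterate_mem_orbit (d := d) (r := r) s u N
    simp [← h', mdelW_length]
  obtain ⟨a, b, hab, he⟩ : ∃ a b : ℕ, a < b ∧ (mdelW d r s)^[a] u = (mdelW d r s)^[b] u := by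
    have := hfin.to_subtype
    obtain ⟨a, b, hne, he⟩ := Finite.exists_ne_map_eq_of_infinite
      (fun N : ℕ => (⟨(mdelW d r s)^[N] u, hm N⟩ : {l : List Q | l.length = u.length}))
    have he' := congrArg Subtype.val he
    rcases lt_or_gt_of_ne hne with h | h
    · exact ⟨a, b, h, he'⟩
    · exact ⟨b, a, h, he'.symm⟩
  obtain ⟨c, rfl⟩ := Nat.exists_eq_add_of_lt hab
  rw [show a + c + 1 = a + (c + 1) by ring, Function.iterate_add_apply] at he
  have := (mdelW_inj hr s).iterate a he
  rw [Function.iterate_succ_apply] at this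
  have hm2 := iterate_mem_orbit (d := d) (r := r) s (mdelW d r s u) c
  rwa [← this] at hm2

theorem IsJWord.act {w : List Q} (h : IsJWord d r t w) (s : List A) :
    IsJWord d r t (mdelW d r s w) := by
  refine ⟨fun i hi hi' => ?_, fun l hl hl' => ?_⟩
  · rw [mdelW_length] at hi
    rw [mdelW_take]
    exact mOrbit_trans (h.1 i hi hi') ⟨s, rfl⟩
  · rw [mdelW_length] at hl'
    rw [mdelW_take]
    exact fun v hv => h.2 l hl hl' v (mOrbit_trans ⟨s, rfl⟩ hv)

theorem IsStem.act {w : List Q} (h : IsStem d r t w) (s : List A) :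
    IsStem d r t (mdelW d r s w) :=
  ⟨h.1.act s, by rw [mdelW_length, h.2]⟩

theorem IsStem.mem {w : List Q} (h : IsStem d r t w) : w ∈ mOrbit d r t := by
  have := h.1.1 t.length h.2.ge le_rfl
  rwa [← h.2, List.take_length, h.2, List.take_length] at this

theorem StemEquiv.act {u v : List Q} (h : StemEquiv d r t u v) (s : List A) :
    StemEquiv d r t (mdelW d r s u) (mdelW d r s v) := by
  obtain ⟨p, hj, hid⟩ := h
  refine ⟨mdelW d r (mrhoW d r u s) p, ?_, fun w => ?_⟩
  · have := hj.act s
    rwa [mdelW_append, hid, mdelW_append] at this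
  · rw [← mdelW_append]
    have := hid (s ++ w)
    rw [mrhoW_append_word, hid] at this
    exact List.append_cancel_left this

theorem EdgeLiftable.prepend {w e : List Q} (h : EdgeLiftable d r w e) (p : List Q) :
    EdgeLiftable d r (p ++ w) e := by
  rintro _ ⟨s, rfl⟩
  obtain ⟨v', hv', hs⟩ := h _ ⟨mrhoW d r p s, rfl⟩
  refine ⟨v', hv', ?_⟩
  rw [mdelW_append]
  exact hs.trans (List.suffix_append _ _)

theorem StemEquiv.trans' {a b c : List Q} (ha : a.length = t.length) (hb : b.length = t.length)
    (h : StemEquiv d r t a b) (h' : StemEquiv d r t b c) : StemEquiv d r t a c := by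
  obtain ⟨p, hj, hid⟩ := h
  obtain ⟨q, hj', hid'⟩ := h'
  refine ⟨p ++ b ++ q, ?_, fun w => ?_⟩
  · have e1 : a ++ (p ++ b ++ q) ++ c = (a ++ p ++ b) ++ (q ++ c) := by simp
    have e2 : a ++ (p ++ b ++ q) ++ c = (a ++ p) ++ (b ++ q ++ c) := by simp
    have htake : ∀ i, i ≤ (a ++ p ++ b).length →
        (a ++ (p ++ b ++ q) ++ c).take i = (a ++ p ++ b).take i := by
      intro i hi
      rw [e1, List.take_append_of_le_length hi]
    refine ⟨fun i hi hi' => ?_, fun l hl hl' => ?_⟩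
    · have : i ≤ (a ++ p ++ b).length := by simp; omega
      rw [htake i this]
      exact hj.1 i this hi'
    · by_cases hc : l + 1 ≤ (a ++ p ++ b).length
      · rw [htake _ hc]
        exact hj.2 l hl hc
      · have hlen : l < (a ++ p).length + (b ++ q ++ c).length := by
          rwa [e2, List.length_append] at hl'
        have hc2 : (a ++ p).length + b.length ≤ l := by
          rw [List.length_append] at hc; omega
        have e3 : l + 1 = (a ++ p).length + ((l - (a ++ p).length) + 1) := by omega
        rw [e2, e3, List.take_length_add_append]
        exact (hj'.2 (l - (a ++ p).length) (by omega) (by omega)).prepend _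
  · have e : a ++ (p ++ b ++ q) = (a ++ p) ++ (b ++ q) := by simp
    rw [e, mrhoW_append, hid, hid']

theorem stemClass_finite [Finite Q] (u : List Q) :
    {v | IsStem d r t v ∧ StemEquiv d r t u v}.Finite :=
  (List.finite_length_eq Q t.length).subset fun _ hv => hv.1.2

theorem stem_move [Finite Q] (hr : MReversible d) {u v : List Q} (hu : IsStem d r t u)
    (hv : IsStem d r t v) : ∃ s, mdelW d r s u = v :=
  mOrbit_trans (mOrbit_symm hr hu.mem) hv.mem

theorem stemClass_le [Finite Q] (hr : MReversible d) {u v : List Q} (hu : IsStem d r t u)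
    (hv : IsStem d r t v) :
    {w | IsStem d r t w ∧ StemEquiv d r t u w}.ncard ≤
      {w | IsStem d r t w ∧ StemEquiv d r t v w}.ncard := by
  obtain ⟨s, rfl⟩ := stem_move hr hu hv
  exact Set.ncard_le_ncard_of_injOn (mdelW d r s)
    (fun w hw => ⟨hw.1.act s, hw.2.act s⟩) (mdelW_inj hr s).injOn (stemClass_finite _)

theorem stem_euclid [Finite Q] (hr : MReversible d) {g z w : List Q} (hg : IsStem d r t g)
    (hz : IsStem d r t z) (hw : IsStem d r t w) (h : StemEquiv d r t g z)
    (h' : StemEquiv d r t g w) : StemEquiv d r t z w := by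
  have hsub : {w | IsStem d r t w ∧ StemEquiv d r t z w} ⊆
      {w | IsStem d r t w ∧ StemEquiv d r t g w} :=
    fun x hx => ⟨hx.1, h.trans' hg.2 hz.2 hx.2⟩
  have := Set.eq_of_subset_of_ncard_le hsub (stemClass_le hr hg hz) (stemClass_finite _)
  have hm : w ∈ {w | IsStem d r t w ∧ StemEquiv d r t g w} := ⟨hw, h'⟩
  rw [← this] at hm
  exact hm.2

theorem count_le [Finite Q] (hr : MReversible d)
    (u₁ u₂ g₁ g₂ : List Q) (k : ℕ) (hlen : u₁.length = u₂.length)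
    (hg₁ : IsStem d r t g₁) (hg₂ : IsStem d r t g₂)
    (hp₁ : ∃ z : List Q, IsStem d r t z ∧ StemEquiv d r t g₁ z ∧ u₁ <+: z)
    (hp₂ : ∃ z : List Q, IsStem d r t z ∧ StemEquiv d r t g₂ z ∧ u₂ <+: z) :
    {v : List Q | v.length = k ∧
        ∃ z : List Q, IsStem d r t z ∧ StemEquiv d r t g₁ z ∧ (u₁ ++ v) <+: z}.ncard ≤
      {v : List Q | v.length = k ∧
        ∃ z : List Q, IsStem d r t z ∧ StemEquiv d r t g₂ z ∧ (u₂ ++ v) <+: z}.ncard := by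
  obtain ⟨z₁, hz₁, he₁, y₁, hy₁⟩ := hp₁
  obtain ⟨z₂, hz₂, he₂, y₂, hy₂⟩ := hp₂
  obtain ⟨s, hs⟩ := stem_move hr hz₁ hz₂
  have hu : mdelW d r s u₁ = u₂ := by
    rw [← hy₁, ← hy₂, mdelW_append] at hs
    exact (List.append_inj hs (by rw [mdelW_length, hlen])).1
  refine Set.ncard_le_ncard_of_injOn (mdelW d r (mrhoW d r u₁ s)) ?_
    (mdelW_inj hr _).injOn ((List.finite_length_eq Q k).subset fun _ hv => hv.1)
  rintro v ⟨hvk, z, hz, he, y, hy⟩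
  refine ⟨by rw [mdelW_length, hvk], mdelW d r s z, hz.act s, ?_, ?_⟩
  · have h1 := (stem_euclid hr hg₁ hz₁ hz he₁ he).act s
    rw [hs] at h1
    exact he₂.trans' hg₂.2 hz₂.2 h1
  · rw [← hy, mdelW_append, mdelW_append, hu]
    exact List.prefix_append _ _

end Helpers

/-- Fix a `j`-word `u` of length `< n`, a `∼`-class (represented by a stem `g`)
containing a stem with prefix `u`, and `k` with `|u| + k ≤ n`. The number of words
`v ∈ Q^k` such that `u·v` is a prefix of a stem of the class depends only on `|u|`
and `k`, not on the choice of `u` nor of the class. -/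
theorem statement15 [Fintype Q] [Fintype A] [Nonempty Q] [Nonempty A]
    (d : A → Q → Q) (r : Q → A → A)
    (hbi : MBireversible d r) (hconn : MConnected d r)
    (hnab : ¬ HasActiveSelfLiftableBranch d r)
    (t : List Q) (ht : IsJungleTrunk d r t)
    (u₁ u₂ g₁ g₂ : List Q) (k : ℕ)
    (hu₁ : IsJWord d r t u₁) (hu₂ : IsJWord d r t u₂)
    (hlen : u₁.length = u₂.length) (hlt : u₁.length < t.length)
    (hg₁ : IsStem d r t g₁) (hg₂ : IsStem d r t g₂)
    (hp₁ : ∃ z : List Q, IsStem d r t z ∧ StemEquiv d r t g₁ z ∧ u₁ <+: z)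
    (hp₂ : ∃ z : List Q, IsStem d r t z ∧ StemEquiv d r t g₂ z ∧ u₂ <+: z)
    (hk : u₁.length + k ≤ t.length) :
    {v : List Q | v.length = k ∧
        ∃ z : List Q, IsStem d r t z ∧ StemEquiv d r t g₁ z ∧ (u₁ ++ v) <+: z}.ncard =
      {v : List Q | v.length = k ∧
        ∃ z : List Q, IsStem d r t z ∧ StemEquiv d r t g₂ z ∧ (u₂ ++ v) <+: z}.ncard := by
  exact le_antisymm (count_le hbi.2.1 u₁ u₂ g₁ g₂ k hlen hg₁ hg₂ hp₁ hp₂)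
    (count_le hbi.2.1 u₂ u₁ g₂ g₁ k hlen.symm hg₂ hg₁ hp₂ hp₁)
end
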